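/- Let N ≥ 1 and let L : Fin N → Set (ℝ × ℝ) be a family of pairwise distinct affine lines in the plane. Let V = {p ∈ ℝ × ℝ | ∃ i j, i ≠ j ∧ p ∈ L i ∧ p ∈ L j} be the set of intersection points, for each i let e i be the number of connected components of L i \ (⋃ j ≠ i, L j), and let F be the number of connected components of (ℝ × ℝ) \ (⋃ i, L i). Then the total complexity of the induced planar subdivision satisfies Nat.card V + (∑ i, e i) + F ≤ 2·N² + 1. -/

import Mathlib

/-- An affine line in the plane: a set of the form `{a + t • v : t ∈ ℝ}` with `v ≠ 0`. -/
def IsAffineLine (L : Set (ℝ × ℝ)) : Prop :=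
  ∃ a v : ℝ × ℝ, v ≠ 0 ∧ L = {p | ∃ t : ℝ, p = a + t • v}

section SignPatterns

variable {ι E : Type*} [AddCommGroup E] [Module ℝ E]

/-- The points of `C` at which none of the functionals `f i`, `i ∈ s`, vanishes. -/
def nonvanishing (f : ι → E →ᵃ[ℝ] ℝ) (C : Set E) (s : Finset ι) : Set E :=
  {p | p ∈ C ∧ ∀ i ∈ s, f i p ≠ 0}

open Classical in
/-- The set of indices in `s` whose functional is positive at `p`. -/
noncomputable def positiveSet (f : ι → E →ᵃ[ℝ] ℝ) (s : Finset ι) (p : E) : Finset ι :=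
  s.filter fun i => 0 < f i p

/-- The sign patterns of the functionals `f i`, `i ∈ s`, realized at points of `C` where none of
them vanishes. -/
def signPatterns (f : ι → E →ᵃ[ℝ] ℝ) (C : Set E) (s : Finset ι) : Set (Finset ι) :=
  positiveSet f s '' nonvanishing f C s

lemma mem_positiveSet {f : ι → E →ᵃ[ℝ] ℝ} {s : Finset ι} {p : E} {i : ι} :
    i ∈ positiveSet f s p ↔ i ∈ s ∧ 0 < f i p := by
  simp [positiveSet]

lemma convex_setOf_positiveSet_eq (f : ι → E →ᵃ[ℝ] ℝ) {C : Set E} (hC : Convex ℝ C)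
    (s : Finset ι) (T : Finset ι) :
    Convex ℝ {p | p ∈ nonvanishing f C s ∧ positiveSet f s p = T} := by
  rintro p ⟨⟨hpC, hp⟩, hpT⟩ q ⟨⟨hqC, hq⟩, hqT⟩ a b ha hb hab
  have key : ∀ i ∈ s, f i (a • p + b • q) ≠ 0 ∧ (0 < f i (a • p + b • q) ↔ i ∈ T) := by
    intro i hi
    have hcomb : f i (a • p + b • q) = a * f i p + b * f i q := by
      simpa using Convex.combo_affine_apply (f := f i) (x := p) (y := q) hab
    have h1 : i ∈ T ↔ 0 < f i p := by rw [← hpT, mem_positiveSet]; simp [hi]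
    have h2 : i ∈ T ↔ 0 < f i q := by rw [← hqT, mem_positiveSet]; simp [hi]
    rw [hcomb]
    by_cases hT : i ∈ T
    · have : 0 < a * f i p + b * f i q :=
        convex_Ioi (𝕜 := ℝ) (0 : ℝ) (h1.1 hT) (h2.1 hT) ha hb hab
      exact ⟨this.ne', by simp [hT, this]⟩
    · have hp0 : f i p < 0 := lt_of_le_of_ne (not_lt.1 fun h => hT (h1.2 h)) (hp i hi)
      have hq0 : f i q < 0 := lt_of_le_of_ne (not_lt.1 fun h => hT (h2.2 h)) (hq i hi)
      have : a * f i p + b * f i q < 0 :=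
        convex_Iio (𝕜 := ℝ) (0 : ℝ) hp0 hq0 ha hb hab
      exact ⟨this.ne, by simp [hT, this.le]⟩
  refine ⟨⟨hC hpC hqC ha hb hab, fun i hi => (key i hi).1⟩, ?_⟩
  ext i
  rw [mem_positiveSet]
  constructor
  · rintro ⟨hi, h⟩
    exact (key i hi).2.1 h
  · intro h
    have hi : i ∈ s := by
      rw [← hpT, mem_positiveSet] at h
      exact h.1
    exact ⟨hi, (key i hi).2.2 h⟩

lemma card_connectedComponents_nonvanishing_le [Finite ι] [TopologicalSpace E] [ContinuousAdd E]
    [ContinuousSMul ℝ E] (f : ι → E →ᵃ[ℝ] ℝ) {C : Set E} (hC : Convex ℝ C) (s : Finset ι) :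
    Nat.card (ConnectedComponents (nonvanishing f C s)) ≤ (signPatterns f C s).ncard := by
  rw [← Nat.card_coe_set_eq]
  have hsurj := ConnectedComponents.surjective_coe (α := nonvanishing f C s)
  choose r hr using hsurj
  refine Nat.card_le_card_of_injective
    (fun c => (⟨positiveSet f s (r c), r c, (r c).2, rfl⟩ : signPatterns f C s)) ?_
  intro c d hcd
  have hT : positiveSet f s (r c) = positiveSet f s (r d) := congrArg Subtype.val hcd
  rw [← hr c, ← hr d, ConnectedComponents.coe_eq_coe']
  have hpre := (convex_setOf_positiveSet_eq f hC s (positiveSet f s (r d))).isPreconnected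
  have hpre' : IsPreconnected
      {p : nonvanishing f C s | positiveSet f s p = positiveSet f s (r d)} := by
    rw [← Topology.IsInducing.subtypeVal.isPreconnected_image]
    convert hpre using 1
    ext p
    simp [and_comm]
  exact hpre'.subset_connectedComponent (by simp) hT

lemma ncard_signPatterns_insert_le [Finite ι] [DecidableEq ι] (f : ι → E →ᵃ[ℝ] ℝ) {C : Set E}
    (hC : Convex ℝ C) (a : ι) (s : Finset ι) :
    (signPatterns f C (insert a s)).ncard ≤
      (signPatterns f C s).ncard + (signPatterns f (C ∩ {p | f a p = 0}) s).ncard := by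
  set P := positiveSet f s '' {p | p ∈ nonvanishing f C s ∧ 0 < f a p}
  set Q := positiveSet f s '' {p | p ∈ nonvanishing f C s ∧ f a p < 0}
  have hsub : signPatterns f C (insert a s) ⊆ (insert a) '' P ∪ Q := by
    rintro _ ⟨p, ⟨hpC, hp⟩, rfl⟩
    have hps : p ∈ nonvanishing f C s := ⟨hpC, fun i hi => hp i (Finset.mem_insert_of_mem hi)⟩
    rcases (hp a (Finset.mem_insert_self a s)).lt_or_gt with h | h
    · right
      refine ⟨p, ⟨hps, h⟩, ?_⟩
      simp [positiveSet, Finset.filter_insert, h.le]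
    · left
      refine ⟨_, ⟨p, ⟨hps, h⟩, rfl⟩, ?_⟩
      simp [positiveSet, Finset.filter_insert, h]
  have hunion : P ∪ Q ⊆ signPatterns f C s := by
    rintro _ (⟨p, hp, rfl⟩ | ⟨p, hp, rfl⟩) <;> exact ⟨p, hp.1, rfl⟩
  have hinter : P ∩ Q ⊆ signPatterns f (C ∩ {p | f a p = 0}) s := by
    rintro T ⟨⟨p, ⟨hp, hpa⟩, hpT⟩, ⟨q, ⟨hq, hqa⟩, hqT⟩⟩
    have hd : 0 < f a p - f a q := by linarith
    have hab : -f a q / (f a p - f a q) + f a p / (f a p - f a q) = 1 := by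
      field_simp; ring
    obtain ⟨⟨hzC, hz⟩, hzT⟩ := convex_setOf_positiveSet_eq f hC s T ⟨hp, hpT⟩ ⟨hq, hqT⟩
      (div_nonneg (by linarith) hd.le) (div_nonneg hpa.le hd.le) hab
    refine ⟨_, ⟨⟨hzC, ?_⟩, hz⟩, hzT⟩
    have := Convex.combo_affine_apply (f := f a) (x := p) (y := q) hab
    rw [Set.mem_ofPred_eq, this]
    simp only [smul_eq_mul]
    field_simp; ring
  calc (signPatterns f C (insert a s)).ncard ≤ ((insert a) '' P ∪ Q).ncard :=
        Set.ncard_le_ncard hsub (Set.toFinite _)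
    _ ≤ ((insert a) '' P).ncard + Q.ncard := Set.ncard_union_le _ _
    _ ≤ P.ncard + Q.ncard :=
        Nat.add_le_add_right (Set.ncard_image_le (Set.toFinite P)) _
    _ = (P ∪ Q).ncard + (P ∩ Q).ncard :=
        (Set.ncard_union_add_ncard_inter P Q (Set.toFinite _) (Set.toFinite _)).symm
    _ ≤ _ := Nat.add_le_add (Set.ncard_le_ncard hunion (Set.toFinite _))
        (Set.ncard_le_ncard hinter (Set.toFinite _))

lemma ncard_signPatterns_empty_le (f : ι → E →ᵃ[ℝ] ℝ) (C : Set E) :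
    (signPatterns f C ∅).ncard ≤ 1 := by
  have : signPatterns f C ∅ ⊆ {∅} := by
    rintro _ ⟨p, -, rfl⟩
    simp [positiveSet]
  simpa using Set.ncard_le_ncard this

lemma ncard_signPatterns_le_one (f : ι → E →ᵃ[ℝ] ℝ) {C : Set E} (hC : C.Subsingleton)
    (s : Finset ι) : (signPatterns f C s).ncard ≤ 1 := by
  have : (signPatterns f C s).Subsingleton :=
    (hC.anti fun p (hp : p ∈ nonvanishing f C s) => hp.1).image _
  exact (Set.ncard_le_one this.finite).2 fun _ hS _ hT => this hS hT

/-- If every functional vanishes at most once on `C`, then there are at most `#s + 1` sign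
patterns on `C`. -/
lemma ncard_signPatterns_le_card_add_one [Finite ι] (f : ι → E →ᵃ[ℝ] ℝ) {C : Set E}
    (hC : Convex ℝ C) (s : Finset ι)
    (hsub : ∀ i ∈ s, (C ∩ {p | f i p = 0}).Subsingleton) :
    (signPatterns f C s).ncard ≤ s.card + 1 := by
  classical
  induction s using Finset.induction_on with
  | empty => simpa using ncard_signPatterns_empty_le f C
  | insert a s ha ih =>
    have h1 := ncard_signPatterns_insert_le f hC a s
    have h2 := ih fun i hi => hsub i (Finset.mem_insert_of_mem hi)
    have h3 := ncard_signPatterns_le_one f (hsub a (Finset.mem_insert_self a s)) s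
    rw [Finset.card_insert_of_notMem ha]
    lia

/-- If the zero sets of any two of the functionals meet at most once, then there are at most
`(#s + 1).choose 2 + 1` sign patterns. -/
lemma ncard_signPatterns_univ_le [Finite ι] (f : ι → E →ᵃ[ℝ] ℝ)
    (hsub : ∀ i j, i ≠ j → ({p | f i p = 0} ∩ {p | f j p = 0}).Subsingleton) (s : Finset ι) :
    (signPatterns f Set.univ s).ncard ≤ (s.card + 1).choose 2 + 1 := by
  classical
  induction s using Finset.induction_on with
  | empty => simpa using ncard_signPatterns_empty_le f Set.univ
  | insert a s ha ih =>
    have h1 := ncard_signPatterns_insert_le f convex_univ a s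
    have hconv : Convex ℝ (Set.univ ∩ {p | f a p = 0}) := by
      rw [Set.univ_inter]
      exact (convex_singleton (0 : ℝ)).affine_preimage (f a)
    have h2 := ncard_signPatterns_le_card_add_one f hconv s fun i hi => by
      rw [Set.univ_inter]
      exact hsub a i fun h => ha (h ▸ hi)
    rw [Finset.card_insert_of_notMem ha, Nat.choose_succ_succ' (s.card + 1) 1, Nat.choose_one_right]
    lia

end SignPatterns

/-- A line is the zero set of an affine functional. -/
lemma IsAffineLine.exists_affineMap {L : Set (ℝ × ℝ)} (hL : IsAffineLine L) :
    ∃ f : (ℝ × ℝ) →ᵃ[ℝ] ℝ, L = {p | f p = 0} := by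
  obtain ⟨a, v, hv, rfl⟩ := hL
  refine ⟨(v.1 • LinearMap.snd ℝ ℝ ℝ - v.2 • LinearMap.fst ℝ ℝ ℝ).toAffineMap -
    AffineMap.const ℝ (ℝ × ℝ) (v.1 * a.2 - v.2 * a.1), ?_⟩
  ext p
  simp only [Set.mem_ofPred_eq, AffineMap.coe_sub, Pi.sub_apply, LinearMap.coe_toAffineMap,
    LinearMap.sub_apply, LinearMap.smul_apply, LinearMap.fst_apply, LinearMap.snd_apply,
    smul_eq_mul, AffineMap.const_apply]
  constructor
  · rintro ⟨t, rfl⟩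
    simp
    ring
  · intro h
    have hv' : v.1 ≠ 0 ∨ v.2 ≠ 0 := by
      by_contra! hcon
      exact hv (Prod.ext hcon.1 hcon.2)
    rcases hv' with h1 | h2
    · refine ⟨(p.1 - a.1) / v.1, Prod.ext ?_ ?_⟩
      · simp; field_simp; ring
      · simp; field_simp; linarith
    · refine ⟨(p.2 - a.2) / v.2, Prod.ext ?_ ?_⟩
      · simp; field_simp; linarith
      · simp; field_simp; ring

/-- A line is determined by any two of its points. -/
lemma IsAffineLine.eq_of_mem {L : Set (ℝ × ℝ)} (hL : IsAffineLine L) {p q : ℝ × ℝ} (hp : p ∈ L)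
    (hq : q ∈ L) (hpq : p ≠ q) : L = {x | ∃ t : ℝ, x = p + t • (q - p)} := by
  obtain ⟨a, v, hv, rfl⟩ := hL
  obtain ⟨t, rfl⟩ := hp
  obtain ⟨u, rfl⟩ := hq
  have htu : u - t ≠ 0 := fun h => hpq (by rw [sub_eq_zero.1 h])
  ext x
  constructor
  · rintro ⟨w, rfl⟩
    refine ⟨(w - t) / (u - t), ?_⟩
    rw [add_sub_add_left_eq_sub, ← sub_smul, smul_smul, div_mul_cancel₀ _ htu]
    module
  · rintro ⟨w, rfl⟩
    exact ⟨t + w * (u - t), by module⟩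

lemma IsAffineLine.subsingleton_inter {L M : Set (ℝ × ℝ)} (hL : IsAffineLine L)
    (hM : IsAffineLine M) (hLM : L ≠ M) : (L ∩ M).Subsingleton := by
  intro p hp q hq
  by_contra hpq
  exact hLM ((hL.eq_of_mem hp.1 hq.1 hpq).trans (hM.eq_of_mem hp.2 hq.2 hpq).symm)

/-- Sets any two of which meet at most once have at most `N.choose 2` pairwise intersection
points. -/
lemma card_pairwise_inter_le {ι α : Type*} [Fintype ι] (L : ι → Set α)
    (hsub : ∀ i j, i ≠ j → (L i ∩ L j).Subsingleton) :
    Nat.card {p : α | ∃ i j, i ≠ j ∧ p ∈ L i ∧ p ∈ L j} ≤ (Fintype.card ι).choose 2 := by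
  classical
  have hex : ∀ p : {p : α | ∃ i j, i ≠ j ∧ p ∈ L i ∧ p ∈ L j},
      ∃ T ∈ Finset.powersetCard 2 (Finset.univ : Finset ι), ∀ i ∈ T, (p : α) ∈ L i := by
    rintro ⟨p, i, j, hij, hi, hj⟩
    refine ⟨{i, j}, by simp [Finset.mem_powersetCard, Finset.card_pair hij], ?_⟩
    simp [hi, hj]
  choose T hT hTL using hex
  have hinj : Function.Injective fun p =>
      (⟨T p, hT p⟩ : Finset.powersetCard 2 (Finset.univ : Finset ι)) := by
    intro p q hpq
    have heq : T p = T q := congrArg Subtype.val hpq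
    obtain ⟨i, j, hij, hTp⟩ := Finset.card_eq_two.1 (Finset.mem_powersetCard.1 (hT p)).2
    have hi : i ∈ T p := by simp [hTp]
    have hj : j ∈ T p := by simp [hTp]
    exact Subtype.ext (hsub i j hij ⟨hTL p i hi, hTL p j hj⟩
      ⟨hTL q i (heq ▸ hi), hTL q j (heq ▸ hj)⟩)
  simpa using Nat.card_le_card_of_injective _ hinj

theorem stmt_12 (N : ℕ) (hN : 1 ≤ N) (L : Fin N → Set (ℝ × ℝ))
    (hline : ∀ i, IsAffineLine (L i)) (hdist : Function.Injective L) :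
    Nat.card {p : ℝ × ℝ | ∃ i j, i ≠ j ∧ p ∈ L i ∧ p ∈ L j} +
        (∑ i : Fin N,
          Nat.card (ConnectedComponents ↥(L i \ ⋃ (j) (_ : j ≠ i), L j))) +
        Nat.card (ConnectedComponents ↥((⋃ i, L i)ᶜ)) ≤ 2 * N ^ 2 + 1 := by
  choose f hf using fun i => (hline i).exists_affineMap
  have hsub : ∀ i j, i ≠ j → (L i ∩ L j).Subsingleton := fun i j hij =>
    (hline i).subsingleton_inter (hline j) (hdist.ne hij)
  have hV := card_pairwise_inter_le L hsub
  rw [Fintype.card_fin] at hV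
  have hE : ∀ i, Nat.card (ConnectedComponents ↥(L i \ ⋃ (j) (_ : j ≠ i), L j)) ≤ N := by
    intro i
    have hset : L i \ ⋃ (j) (_ : j ≠ i), L j = nonvanishing f (L i) (Finset.univ.erase i) := by
      ext p
      simp [nonvanishing, hf]
    have hconv : Convex ℝ (L i) := by
      rw [hf i]
      exact (convex_singleton (0 : ℝ)).affine_preimage (f i)
    rw [hset]
    refine (card_connectedComponents_nonvanishing_le f hconv _).trans
      ((ncard_signPatterns_le_card_add_one f hconv _ fun j hj => ?_).trans ?_)
    · rw [← hf j]
      exact hsub i j (Finset.ne_of_mem_erase hj).symm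
    · rw [Finset.card_erase_of_mem (Finset.mem_univ i), Finset.card_univ, Fintype.card_fin]
      lia
  have hF : Nat.card (ConnectedComponents ↥((⋃ i, L i)ᶜ)) ≤ (N + 1).choose 2 + 1 := by
    have hset : (⋃ i, L i)ᶜ = nonvanishing f Set.univ Finset.univ := by
      ext p
      simp [nonvanishing, hf]
    rw [hset]
    refine (card_connectedComponents_nonvanishing_le f convex_univ _).trans
      ((ncard_signPatterns_univ_le f (fun i j hij => ?_) _).trans ?_)
    · rw [← hf i, ← hf j]
      exact hsub i j hij
    · simp
  have hsum := Finset.sum_le_card_nsmul Finset.univ _ N fun i _ => hE i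
  rw [Finset.card_univ, Fintype.card_fin, smul_eq_mul] at hsum
  have hchoose : N.choose 2 + (N + 1).choose 2 = N * N := by
    obtain ⟨n, rfl⟩ := Nat.exists_eq_add_of_le' hN
    have h1 := Nat.triangle_succ (n + 1)
    have h2 := Nat.triangle_succ n
    rw [Nat.choose_two_right, Nat.choose_two_right, h1, h2]
    have h3 : n * (n - 1) / 2 * 2 = n * (n - 1) :=
      Nat.div_mul_cancel (Nat.even_mul_pred_self n).two_dvd
    rcases n with _ | n
    · simp
    · simp only [Nat.add_sub_cancel] at h2 h3 ⊢
      nlinarith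
  rw [pow_two]
  lia
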